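/- arXiv:1804.00391 — 3 statements merged into one kernel-verified Lean document; each statement's English description precedes it below -/
import Mathlib

section
/- Assume V ≠ ∅ and pa > 0. For every value v ∈ {C_e : e ∈ V}, the denominator D := (v−pa−C0)·∑_{e∈V: C_e > v} 1/(C_e−C0) + ∑_{e∈V: C_e ≤ v} (C_e−pa−C0)/(C_e−C0) is strictly positive, and (v−C0)/D > ( ∑_{e∈V} 1/(C_e−C0) )^{-1}. (This is the key inequality showing that the sequential-game threshold defense cost strictly exceeds the normal-form threshold c̄d = (∑_{e∈V} 1/(C_e−C0))^{-1}.) -/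
open Finset

/-- **Lemma 6 (key inequality): the sequential-game threshold defense cost strictly
exceeds the normal-form threshold.**
Let `V = {e : C_e − pa > C0}` be the (nonempty) set of vulnerable facilities and let
`v ∈ {C_e : e ∈ V}`. Then the denominator
`D = (v−pa−C0)·∑_{e∈V, C_e>v} 1/(C_e−C0) + ∑_{e∈V, C_e≤v} (C_e−pa−C0)/(C_e−C0)`
is strictly positive and `(v−C0)/D > (∑_{e∈V} 1/(C_e−C0))⁻¹`. -/
theorem sequential_threshold_exceeds_normal_threshold
    {E : Type*} [Fintype E] [DecidableEq E] [Nonempty E]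
    (C0 : ℝ) (Ce : E → ℝ) (pa : ℝ) (hpa : 0 < pa)
    (hV : ∃ e : E, C0 < Ce e - pa)
    (v : ℝ) (hv : ∃ e : E, C0 < Ce e - pa ∧ Ce e = v) :
    0 < (v - pa - C0) *
          (∑ e ∈ Finset.univ.filter (fun e => C0 < Ce e - pa ∧ v < Ce e), 1 / (Ce e - C0))
        + ∑ e ∈ Finset.univ.filter (fun e => C0 < Ce e - pa ∧ Ce e ≤ v),
            (Ce e - pa - C0) / (Ce e - C0) ∧
    (∑ e ∈ Finset.univ.filter (fun e => C0 < Ce e - pa), 1 / (Ce e - C0))⁻¹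
      < (v - C0) /
        ((v - pa - C0) *
            (∑ e ∈ Finset.univ.filter (fun e => C0 < Ce e - pa ∧ v < Ce e), 1 / (Ce e - C0))
          + ∑ e ∈ Finset.univ.filter (fun e => C0 < Ce e - pa ∧ Ce e ≤ v),
              (Ce e - pa - C0) / (Ce e - C0)) := by
  obtain ⟨e₀, he₀, rfl⟩ := hv
  have hS : ∑ e ∈ univ.filter (fun e => C0 < Ce e - pa), 1 / (Ce e - C0) =
      ∑ e ∈ univ.filter (fun e => C0 < Ce e - pa ∧ Ce e₀ < Ce e), 1 / (Ce e - C0) +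
        ∑ e ∈ univ.filter (fun e => C0 < Ce e - pa ∧ Ce e ≤ Ce e₀), 1 / (Ce e - C0) := by
    rw [← sum_filter_add_sum_filter_not _ (fun e => Ce e₀ < Ce e)]
    simp only [filter_filter, not_lt]
  have hne : (univ.filter (fun e => C0 < Ce e - pa ∧ Ce e ≤ Ce e₀)).Nonempty :=
    ⟨e₀, by simp [he₀]⟩
  have hA : 0 ≤ ∑ e ∈ univ.filter (fun e => C0 < Ce e - pa ∧ Ce e₀ < Ce e),
      1 / (Ce e - C0) := by
    refine sum_nonneg fun e he => one_div_nonneg.2 ?_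
    linarith [(mem_filter.1 he).2.1]
  have hB : 0 < ∑ e ∈ univ.filter (fun e => C0 < Ce e - pa ∧ Ce e ≤ Ce e₀),
      1 / (Ce e - C0) := by
    refine sum_pos (fun e he => one_div_pos.2 ?_) hne
    linarith [(mem_filter.1 he).2.1]
  have hT : 0 < ∑ e ∈ univ.filter (fun e => C0 < Ce e - pa ∧ Ce e ≤ Ce e₀),
      (Ce e - pa - C0) / (Ce e - C0) := by
    refine sum_pos (fun e he => ?_) hne
    have h := (mem_filter.1 he).2.1
    exact div_pos (by linarith) (by linarith)
  have hTB : ∑ e ∈ univ.filter (fun e => C0 < Ce e - pa ∧ Ce e ≤ Ce e₀),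
      (Ce e - pa - C0) / (Ce e - C0) < (Ce e₀ - C0) *
        ∑ e ∈ univ.filter (fun e => C0 < Ce e - pa ∧ Ce e ≤ Ce e₀), 1 / (Ce e - C0) := by
    rw [mul_sum]
    refine sum_lt_sum_of_nonempty hne fun e he => ?_
    obtain ⟨h, hle⟩ := (mem_filter.1 he).2
    rw [mul_one_div]
    exact div_lt_div_of_pos_right (by linarith) (by linarith)
  have hD := add_pos_of_nonneg_of_pos
    (mul_nonneg (by linarith : 0 ≤ Ce e₀ - pa - C0) hA) hT
  refine ⟨hD, ?_⟩
  rw [hS, lt_div_iff₀ hD, inv_mul_lt_iff₀ (add_pos_of_nonneg_of_pos hA hB)]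
  nlinarith [mul_nonneg hpa.le hA]
end

section
/- Assume V ≠ ∅, pa ≠ C_e − C0 for every e ∈ E, and ∑_{e∈V} pd/(C_e−C0) < 1 (type I regime). Then: in every Nash equilibrium of the normal-form game Γ, the defender's expected utility equals −C0 − |V|·pd and the attacker's expected utility equals C0; and in every SPE of the sequential game Γ̃, the defender's on-path expected utility equals −C0 − pd·∑_{e∈V} (C_e−pa−C0)/(C_e−C0) and the attacker's on-path expected utility equals C0. -/
open Finset

noncomputable section

namespace SecGame

variable {E : Type*} [Fintype E] [DecidableEq E]

/-- Usage cost after the attacker–defender interaction. -/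
def usageCost (C0 : ℝ) (Ce : E → ℝ) (sd : Finset E) : Option E → ℝ
  | some e => if e ∈ sd then C0 else Ce e
  | none => C0

/-- Defender mixed strategy over subsets of facilities. -/
def IsDefMixed (σd : Finset E → ℝ) : Prop :=
  (∀ sd, 0 ≤ σd sd) ∧ ∑ sd : Finset E, σd sd = 1

/-- Attacker mixed strategy over `E ∪ {∅}`. -/
def IsAtkMixed (σa : Option E → ℝ) : Prop :=
  (∀ sa, 0 ≤ σa sa) ∧ ∑ sa : Option E, σa sa = 1

/-- Defender expected utility. -/
def Ud (C0 : ℝ) (Ce : E → ℝ) (pd : ℝ) (σd : Finset E → ℝ) (σa : Option E → ℝ) : ℝ :=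
  ∑ sd : Finset E, ∑ sa : Option E,
    σd sd * σa sa * (-(usageCost C0 Ce sd sa) - pd * (sd.card : ℝ))

/-- Attacker expected utility. -/
def Ua (C0 : ℝ) (Ce : E → ℝ) (pa : ℝ) (σd : Finset E → ℝ) (σa : Option E → ℝ) : ℝ :=
  ∑ sd : Finset E, ∑ sa : Option E,
    σd sd * σa sa * (usageCost C0 Ce sd sa - pa * (if sa = none then 0 else 1))

/-- Security effort vector induced by a defender mixed strategy. -/
def effort (σd : Finset E → ℝ) (e : E) : ℝ :=
  ∑ sd ∈ Finset.univ.filter (fun sd => e ∈ sd), σd sd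

/-- Nash equilibrium of the normal form game Γ. -/
def IsNE (C0 : ℝ) (Ce : E → ℝ) (pa pd : ℝ) (σd : Finset E → ℝ) (σa : Option E → ℝ) : Prop :=
  IsDefMixed σd ∧ IsAtkMixed σa ∧
  (∀ σd', IsDefMixed σd' → Ud C0 Ce pd σd' σa ≤ Ud C0 Ce pd σd σa) ∧
  (∀ σa', IsAtkMixed σa' → Ua C0 Ce pa σd σa' ≤ Ua C0 Ce pa σd σa)

/-- Security effort vectors in the unit box `[0,1]^E`. -/
def InBox (ρ : E → ℝ) : Prop := ∀ e, 0 ≤ ρ e ∧ ρ e ≤ 1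

/-- Defender expected utility as a function of the security effort vector. -/
def UdRho (C0 : ℝ) (Ce : E → ℝ) (pd : ℝ) (ρ : E → ℝ) (σa : Option E → ℝ) : ℝ :=
  -(∑ e : E, (ρ e * ((C0 - Ce e) * σa (some e) + pd) + Ce e * σa (some e))) - C0 * σa none

/-- Attacker expected utility as a function of the security effort vector. -/
def UaRho (C0 : ℝ) (Ce : E → ℝ) (pa : ℝ) (ρ : E → ℝ) (σa : Option E → ℝ) : ℝ :=
  (∑ e : E, (ρ e * (C0 - Ce e) * σa (some e) + Ce e * σa (some e))) + C0 * σa none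
    - pa * ∑ e : E, σa (some e)

/-- Threshold security effort for a vulnerable facility. -/
def rhoHat (C0 : ℝ) (Ce : E → ℝ) (pa : ℝ) (e : E) : ℝ := (Ce e - pa - C0) / (Ce e - C0)

/-- Subgame perfect equilibrium of the sequential game Γ̃. -/
def IsSPE (C0 : ℝ) (Ce : E → ℝ) (pa pd : ℝ) (ρstar : E → ℝ)
    (σastar : (E → ℝ) → Option E → ℝ) : Prop :=
  InBox ρstar ∧
  (∀ ρ, InBox ρ → IsAtkMixed (σastar ρ) ∧
    ∀ σa, IsAtkMixed σa → UaRho C0 Ce pa ρ σa ≤ UaRho C0 Ce pa ρ (σastar ρ)) ∧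
  (∀ ρ, InBox ρ → UdRho C0 Ce pd ρ (σastar ρ) ≤ UdRho C0 Ce pd ρstar (σastar ρstar))

/-- Net gain of the attacker from attacking `e`, relative to not attacking. -/
def attackGain (C0 : ℝ) (Ce : E → ℝ) (pa : ℝ) (ρ : E → ℝ) (e : E) : ℝ :=
  (1 - ρ e) * (Ce e - C0) - pa

theorem IsAtkMixed.none_eq {σa : Option E → ℝ} (h : IsAtkMixed σa) :
    σa none = 1 - ∑ e, σa (some e) := by
  have := h.2
  rw [Fintype.sum_option] at this
  linarith

theorem isAtkMixed_single (a : Option E) : IsAtkMixed (Pi.single a (1 : ℝ)) := by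
  refine ⟨fun b => ?_, by simp⟩
  by_cases hb : b = a
  · subst hb; simp
  · simp [hb]

theorem isDefMixed_single (s : Finset E) : IsDefMixed (Pi.single s (1 : ℝ)) := by
  refine ⟨fun b => ?_, by simp⟩
  by_cases hb : b = s
  · subst hb; simp
  · simp [hb]

theorem UaRho_eq (C0 : ℝ) (Ce : E → ℝ) (pa : ℝ) (ρ : E → ℝ) {σa : Option E → ℝ}
    (h : IsAtkMixed σa) :
    UaRho C0 Ce pa ρ σa = C0 + ∑ e, σa (some e) * attackGain C0 Ce pa ρ e := by
  rw [UaRho, h.none_eq]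
  have : ∑ e, σa (some e) * attackGain C0 Ce pa ρ e
      = ∑ e, (ρ e * (C0 - Ce e) * σa (some e) + Ce e * σa (some e))
        - C0 * ∑ e, σa (some e) - pa * ∑ e, σa (some e) := by
    rw [mul_sum, mul_sum, ← sum_sub_distrib, ← sum_sub_distrib]
    refine sum_congr rfl fun e _ => ?_
    rw [attackGain]; ring
  rw [this]; ring

theorem UdRho_eq (C0 : ℝ) (Ce : E → ℝ) (pd : ℝ) (ρ : E → ℝ) {σa : Option E → ℝ}
    (h : IsAtkMixed σa) :
    UdRho C0 Ce pd ρ σa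
      = -C0 - ∑ e, (σa (some e) * ((1 - ρ e) * (Ce e - C0)) + pd * ρ e) := by
  rw [UdRho, h.none_eq]
  have : ∑ e, (σa (some e) * ((1 - ρ e) * (Ce e - C0)) + pd * ρ e)
      = ∑ e, (ρ e * ((C0 - Ce e) * σa (some e) + pd) + Ce e * σa (some e))
        - C0 * ∑ e, σa (some e) := by
    rw [mul_sum, ← sum_sub_distrib]
    refine sum_congr rfl fun e _ => ?_
    ring
  rw [this]; ring

theorem effort_eq (σd : Finset E → ℝ) (e : E) :
    effort σd e = ∑ sd, σd sd * (if e ∈ sd then 1 else 0) := by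
  simp [effort, sum_filter]

theorem IsDefMixed.inBox_effort {σd : Finset E → ℝ} (h : IsDefMixed σd) :
    InBox (effort σd) := fun _ =>
  ⟨sum_nonneg fun sd _ => h.1 sd,
    (sum_le_sum_of_subset_of_nonneg (filter_subset _ _) fun sd _ _ => h.1 sd).trans h.2.le⟩

theorem effort_single (s : Finset E) (e : E) :
    effort (Pi.single s (1 : ℝ)) e = if e ∈ s then 1 else 0 := by
  rw [effort_eq, sum_eq_single s]
  · simp
  · intro b _ hb; simp [hb]
  · simp

/-- Averaging an affine function of the indicator of `sd` only depends on the effort vector. -/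
theorem sum_mul_affine_indicator {σd : Finset E → ℝ} (h : IsDefMixed σd) (a : ℝ) (b : E → ℝ) :
    ∑ sd, σd sd * (a + ∑ e, b e * (if e ∈ sd then 1 else 0)) = a + ∑ e, b e * effort σd e := by
  simp_rw [effort_eq, mul_add, sum_add_distrib, ← sum_mul, h.2, one_mul, mul_sum]
  congr 1
  rw [sum_comm]
  exact sum_congr rfl fun e _ => sum_congr rfl fun sd _ => by ring

theorem Ua_eq_UaRho (C0 : ℝ) (Ce : E → ℝ) (pa : ℝ) {σd : Finset E → ℝ} (σa : Option E → ℝ)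
    (hd : IsDefMixed σd) :
    Ua C0 Ce pa σd σa = UaRho C0 Ce pa (effort σd) σa := by
  have key := sum_mul_affine_indicator hd
    (C0 * σa none + ∑ e, (Ce e - pa) * σa (some e)) (fun e => (C0 - Ce e) * σa (some e))
  have hR : UaRho C0 Ce pa (effort σd) σa
      = (C0 * σa none + ∑ e, (Ce e - pa) * σa (some e))
        + ∑ e, (C0 - Ce e) * σa (some e) * effort σd e := by
    rw [UaRho, add_assoc, ← sum_add_distrib, mul_sum, add_sub_right_comm, ← sum_sub_distrib,
      add_comm]
    congr 1
    exact sum_congr rfl fun e _ => by ring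
  rw [hR, ← key, Ua]
  refine sum_congr rfl fun sd _ => ?_
  rw [Fintype.sum_option, add_assoc, ← sum_add_distrib, mul_add, mul_sum]
  congr 1
  · simp [usageCost]; ring
  · refine sum_congr rfl fun e _ => ?_
    by_cases he : e ∈ sd <;> simp [usageCost, he] <;> ring

theorem Ud_eq_UdRho (C0 : ℝ) (Ce : E → ℝ) (pd : ℝ) {σd : Finset E → ℝ} {σa : Option E → ℝ}
    (hd : IsDefMixed σd) (ha : IsAtkMixed σa) :
    Ud C0 Ce pd σd σa = UdRho C0 Ce pd (effort σd) σa := by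
  have key := sum_mul_affine_indicator hd
    (-C0 - ∑ e, σa (some e) * (Ce e - C0)) (fun e => σa (some e) * (Ce e - C0) - pd)
  have hR : UdRho C0 Ce pd (effort σd) σa
      = (-C0 - ∑ e, σa (some e) * (Ce e - C0))
        + ∑ e, (σa (some e) * (Ce e - C0) - pd) * effort σd e := by
    rw [UdRho_eq C0 Ce pd _ ha, sub_add, ← sum_sub_distrib]
    congr 1
    exact sum_congr rfl fun e _ => by ring
  rw [hR, ← key, Ud]
  refine sum_congr rfl fun sd _ => ?_
  have hcard : (sd.card : ℝ) = ∑ e, if e ∈ sd then (1 : ℝ) else 0 := by simp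
  have hone : σa none + ∑ e, σa (some e) = 1 := by rw [ha.none_eq]; ring
  have hcost : ∑ sa, σa sa * usageCost C0 Ce sd sa
      = C0 + ∑ e, σa (some e) * (Ce e - C0)
        - ∑ e, σa (some e) * (Ce e - C0) * (if e ∈ sd then 1 else 0) := by
    rw [Fintype.sum_option, ha.none_eq, add_sub_assoc, ← sum_sub_distrib, ← eq_sub_iff_add_eq,
      add_sub_assoc, ← sum_sub_distrib]
    simp only [usageCost]
    have : (1 - ∑ e, σa (some e)) * C0 = C0 + ∑ e, -(σa (some e) * C0) := by
      rw [sum_neg_distrib, ← sum_mul]; ring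
    rw [this]
    congr 1
    refine sum_congr rfl fun e _ => ?_
    split_ifs <;> ring
  have : ∑ sa, σd sd * σa sa * (-(usageCost C0 Ce sd sa) - pd * (sd.card : ℝ))
      = σd sd * (-∑ sa, σa sa * usageCost C0 Ce sd sa - pd * sd.card * ∑ sa, σa sa) := by
    rw [mul_sum, ← sum_neg_distrib, ← sum_sub_distrib, mul_sum]
    exact sum_congr rfl fun sa _ => by ring
  rw [this, hcost, ha.2, hcard]
  simp_rw [sub_mul, sum_sub_distrib, ← mul_sum]
  ring

/-- First-order conditions for an attacker best response `σa` to the effort vector `ρ`: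
with `u` the excess utility over `C0`, all gains are at most `u`, and only actions achieving `u`
are played. -/
theorem attacker_best_response {C0 : ℝ} {Ce : E → ℝ} {pa : ℝ} {ρ : E → ℝ} {σa : Option E → ℝ}
    (ha : IsAtkMixed σa)
    (hbr : ∀ σa', IsAtkMixed σa' → UaRho C0 Ce pa ρ σa' ≤ UaRho C0 Ce pa ρ σa) :
    ∃ u : ℝ, UaRho C0 Ce pa ρ σa = C0 + u ∧ u = ∑ e, σa (some e) * attackGain C0 Ce pa ρ e ∧
      0 ≤ u ∧ (∀ e, attackGain C0 Ce pa ρ e ≤ u) ∧ σa none * u = 0 ∧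
      ∀ e, σa (some e) * (u - attackGain C0 Ce pa ρ e) = 0 := by
  obtain ⟨u, hu⟩ : ∃ u, u = ∑ e, σa (some e) * attackGain C0 Ce pa ρ e := ⟨_, rfl⟩
  have hU := UaRho_eq C0 Ce pa ρ ha
  rw [← hu] at hU
  have h0 : 0 ≤ u := by
    have := hbr _ (isAtkMixed_single none)
    rw [UaRho_eq C0 Ce pa ρ (isAtkMixed_single none), hU] at this
    simpa using this
  have hg : ∀ e, attackGain C0 Ce pa ρ e ≤ u := fun e => by
    have := hbr _ (isAtkMixed_single (some e))
    rw [UaRho_eq C0 Ce pa ρ (isAtkMixed_single (some e)), hU] at this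
    simpa [Pi.single_apply] using this
  have hterm : ∀ e ∈ univ, 0 ≤ σa (some e) * (u - attackGain C0 Ce pa ρ e) := fun e _ =>
    mul_nonneg (ha.1 _) (sub_nonneg.2 (hg e))
  have hnone : 0 ≤ σa none * u := mul_nonneg (ha.1 _) h0
  have hsum : σa none * u + ∑ e, σa (some e) * (u - attackGain C0 Ce pa ρ e) = 0 := by
    simp_rw [mul_sub, sum_sub_distrib, ← hu, ← sum_mul, ha.none_eq]
    ring
  have hnn := sum_nonneg hterm
  refine ⟨u, hU, hu, h0, hg, by linarith, fun e => ?_⟩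
  exact (sum_eq_zero_iff_of_nonneg hterm).1 (by linarith) e (mem_univ e)

/-- A best-responding defender does not protect facilities where protection is too expensive, and
fully protects those where it is profitable. -/
theorem defender_best_response {C0 : ℝ} {Ce : E → ℝ} {pd : ℝ} {σd : Finset E → ℝ}
    {σa : Option E → ℝ} (hd : IsDefMixed σd) (ha : IsAtkMixed σa)
    (hbr : ∀ σd', IsDefMixed σd' → Ud C0 Ce pd σd' σa ≤ Ud C0 Ce pd σd σa) (e : E) :
    (σa (some e) * (Ce e - C0) < pd → effort σd e = 0) ∧
      (pd < σa (some e) * (Ce e - C0) → effort σd e = 1) := by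
  let s : Finset E := univ.filter fun e => pd < σa (some e) * (Ce e - C0)
  have hs := hbr _ (isDefMixed_single s)
  rw [Ud_eq_UdRho C0 Ce pd (isDefMixed_single s) ha, Ud_eq_UdRho C0 Ce pd hd ha,
    UdRho_eq C0 Ce pd _ ha, UdRho_eq C0 Ce pd _ ha, sub_le_sub_iff_left] at hs
  have hbox := hd.inBox_effort
  have hle : ∀ e ∈ univ, σa (some e) * ((1 - effort (Pi.single s 1) e) * (Ce e - C0))
      + pd * effort (Pi.single s 1) e
      ≤ σa (some e) * ((1 - effort σd e) * (Ce e - C0)) + pd * effort σd e := by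
    intro e _
    rw [effort_single]
    have := hbox e
    by_cases he : pd < σa (some e) * (Ce e - C0)
    · simp only [s, mem_filter, mem_univ, true_and, he, if_true]
      nlinarith
    · simp only [s, mem_filter, mem_univ, true_and, he, if_false]
      nlinarith
  have heq := (sum_eq_sum_iff_of_le hle).1 (le_antisymm (sum_le_sum hle) hs) e (mem_univ e)
  rw [effort_single] at heq
  constructor
  · intro h
    simp only [s, mem_filter, mem_univ, true_and, h.not_gt, if_false] at heq
    have : (pd - σa (some e) * (Ce e - C0)) * effort σd e = 0 := by linarith
    exact (mul_eq_zero.1 this).resolve_left (by linarith)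
  · intro h
    simp only [s, mem_filter, mem_univ, true_and, h, if_true] at heq
    have : (pd - σa (some e) * (Ce e - C0)) * (1 - effort σd e) = 0 := by linarith
    linarith [(mul_eq_zero.1 this).resolve_left (by linarith)]

/-- Attacking a non-vulnerable facility yields a strict loss. -/
theorem attackGain_neg_of_not_vulnerable {C0 : ℝ} {Ce : E → ℝ} {pa : ℝ} {ρ : E → ℝ} {e : E}
    (hpa : 0 < pa) (hgen : pa ≠ Ce e - C0) (hρ : InBox ρ) (he : ¬ C0 < Ce e - pa) :
    attackGain C0 Ce pa ρ e < 0 := by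
  have hlt : Ce e - C0 < pa := lt_of_le_of_ne (by linarith) hgen.symm
  obtain ⟨h0, h1⟩ := hρ e
  rw [attackGain]
  rcases le_total 0 (Ce e - C0) with h | h <;> nlinarith

theorem nash_utilities {C0 : ℝ} {Ce : E → ℝ} {pa pd : ℝ} (hpa : 0 < pa) (hpd : 0 < pd)
    (hgen : ∀ e : E, pa ≠ Ce e - C0)
    (hsum : ∑ e ∈ Finset.univ.filter (fun e => C0 < Ce e - pa), pd / (Ce e - C0) < 1)
    {σd : Finset E → ℝ} {σa : Option E → ℝ} (h : IsNE C0 Ce pa pd σd σa) :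
    Ud C0 Ce pd σd σa
      = -C0 - ((Finset.univ.filter (fun e => C0 < Ce e - pa)).card : ℝ) * pd ∧
    Ua C0 Ce pa σd σa = C0 := by
  obtain ⟨hd, ha, hbd, hba⟩ := h
  have hbox := hd.inBox_effort
  have hdef := defender_best_response hd ha hbd
  simp_rw [Ua_eq_UaRho C0 Ce pa _ hd] at hba ⊢
  rw [Ud_eq_UdRho C0 Ce pd hd ha, UdRho_eq C0 Ce pd _ ha]
  obtain ⟨u, hU, -, hu0, hg, hnone, hsupp⟩ := attacker_best_response ha hba
  have hnonV : ∀ e, ¬ C0 < Ce e - pa → σa (some e) = 0 := fun e he => by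
    have := attackGain_neg_of_not_vulnerable hpa (hgen e) hbox he
    exact (mul_eq_zero.1 (hsupp e)).resolve_right (by linarith)
  have hu : u = 0 := by
    by_contra hne
    have hpos : 0 < u := lt_of_le_of_ne hu0 (Ne.symm hne)
    have hn : σa none = 0 := (mul_eq_zero.1 hnone).resolve_right hne
    have htot : ∑ e, σa (some e) = 1 := by linarith [ha.none_eq]
    have hle : ∑ e, σa (some e)
        ≤ ∑ e ∈ univ.filter (fun e => C0 < Ce e - pa), pd / (Ce e - C0) := by
      rw [sum_filter]
      refine sum_le_sum fun e _ => ?_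
      split_ifs with he
      · have hΔ : 0 < Ce e - C0 := by linarith
        rw [le_div_iff₀ hΔ]
        by_contra! hlt
        have h1 := (hdef e).2 hlt
        have h2 : σa (some e) ≠ 0 := by
          intro h0; rw [h0] at hlt; linarith
        have h3 := (mul_eq_zero.1 (hsupp e)).resolve_left h2
        rw [attackGain, h1] at h3
        linarith
      · exact (hnonV e he).le
    linarith
  subst hu
  refine ⟨?_, by linarith⟩
  rw [sub_right_inj, card_eq_sum_ones, Nat.cast_sum, sum_mul, sum_filter]
  refine sum_congr rfl fun e _ => ?_
  split_ifs with he
  · have hΔ : 0 < Ce e - C0 := by linarith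
    have hge := hg e
    have hρ0 : effort σd e ≠ 0 := by
      intro h0; rw [attackGain, h0] at hge; linarith
    have hpdle : pd ≤ σa (some e) * (Ce e - C0) := not_lt.1 fun hlt => hρ0 ((hdef e).1 hlt)
    have hσ : σa (some e) ≠ 0 := by
      intro h0; rw [h0] at hpdle; linarith
    have hgain := (mul_eq_zero.1 (hsupp e)).resolve_left hσ
    have hρ1 : effort σd e ≠ 1 := by
      intro h1; rw [attackGain, h1] at hgain; linarith
    have hpdge : σa (some e) * (Ce e - C0) ≤ pd := not_lt.1 fun hlt => hρ1 ((hdef e).2 hlt)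
    have heq : σa (some e) * (Ce e - C0) = pd := le_antisymm hpdge hpdle
    push_cast
    linear_combination (1 - effort σd e) * heq
  · have h0 := hnonV e he
    have h1 : effort σd e = 0 := (hdef e).1 (by rw [h0]; linarith)
    rw [h0, h1]; ring

/-- Bound on the defender utility when the attacker best responds with excess utility `u`. -/
theorem UdRho_le_of_best_response {C0 : ℝ} {Ce : E → ℝ} {pa pd : ℝ} (hpa : 0 < pa) (hpd : 0 < pd)
    {ρ : E → ℝ} (hρ : InBox ρ) {σa : Option E → ℝ} (ha : IsAtkMixed σa) {u : ℝ}
    (hu : u = ∑ e, σa (some e) * attackGain C0 Ce pa ρ e)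
    (hg : ∀ e, attackGain C0 Ce pa ρ e ≤ u) :
    UdRho C0 Ce pd ρ σa ≤ -C0
      - pd * ∑ e ∈ univ.filter (fun e => C0 < Ce e - pa), (Ce e - pa - C0) / (Ce e - C0)
      - u * (1 - ∑ e ∈ univ.filter (fun e => C0 < Ce e - pa), pd / (Ce e - C0)) := by
  have hatk : u ≤ ∑ e, σa (some e) * ((1 - ρ e) * (Ce e - C0)) := by
    rw [hu]
    refine sum_le_sum fun e _ => mul_le_mul_of_nonneg_left ?_ (ha.1 _)
    rw [attackGain]; linarith
  have hdef : pd * ∑ e ∈ univ.filter (fun e => C0 < Ce e - pa), (Ce e - pa - C0) / (Ce e - C0)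
      - u * ∑ e ∈ univ.filter (fun e => C0 < Ce e - pa), pd / (Ce e - C0)
      ≤ ∑ e, pd * ρ e := by
    rw [mul_sum, mul_sum, ← sum_sub_distrib, sum_filter]
    refine sum_le_sum fun e _ => ?_
    split_ifs with he
    · have hΔ : 0 < Ce e - C0 := by linarith
      have hge := hg e
      rw [attackGain] at hge
      have : pd * ((Ce e - pa - C0) / (Ce e - C0)) - u * (pd / (Ce e - C0))
          = pd * ((Ce e - pa - C0 - u) / (Ce e - C0)) := by ring
      rw [this]
      refine mul_le_mul_of_nonneg_left ?_ hpd.le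
      rw [div_le_iff₀ hΔ]
      linarith
    · exact mul_nonneg hpd.le (hρ e).1
  rw [UdRho_eq C0 Ce pd _ ha, sum_add_distrib]
  linarith

/-- Effort slightly above the thresholds `rhoHat` on vulnerable facilities. -/
def deterrentEffort (C0 : ℝ) (Ce : E → ℝ) (pa t : ℝ) (e : E) : ℝ :=
  if C0 < Ce e - pa then rhoHat C0 Ce pa e + t * (1 - rhoHat C0 Ce pa e) else 0

theorem one_sub_rhoHat {C0 : ℝ} {Ce : E → ℝ} {pa : ℝ} {e : E} (hΔ : 0 < Ce e - C0) :
    1 - rhoHat C0 Ce pa e = pa / (Ce e - C0) := by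
  rw [rhoHat]; field_simp; ring

theorem inBox_deterrentEffort (C0 : ℝ) (Ce : E → ℝ) {pa t : ℝ} (hpa : 0 < pa) (ht0 : 0 < t)
    (ht1 : t ≤ 1) : InBox (deterrentEffort C0 Ce pa t) := fun e => by
  rw [deterrentEffort]
  split_ifs with he
  · have hΔ : 0 < Ce e - C0 := by linarith
    have h1 : 0 ≤ 1 - rhoHat C0 Ce pa e := by rw [one_sub_rhoHat hΔ]; positivity
    have h0 : 0 ≤ rhoHat C0 Ce pa e := div_nonneg (by linarith) hΔ.le
    constructor <;> nlinarith
  · simp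

theorem attackGain_deterrentEffort_neg {C0 : ℝ} {Ce : E → ℝ} {pa t : ℝ} (hpa : 0 < pa)
    (hgen : ∀ e : E, pa ≠ Ce e - C0) (ht0 : 0 < t) (ht1 : t ≤ 1) (e : E) :
    attackGain C0 Ce pa (deterrentEffort C0 Ce pa t) e < 0 := by
  by_cases he : C0 < Ce e - pa
  · have hΔ : 0 < Ce e - C0 := by linarith
    have h : (1 - rhoHat C0 Ce pa e) * (Ce e - C0) = pa := by
      rw [one_sub_rhoHat hΔ, div_mul_cancel₀ _ hΔ.ne']
    have : attackGain C0 Ce pa (deterrentEffort C0 Ce pa t) e = -(t * pa) := by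
      rw [attackGain, deterrentEffort, if_pos he]
      linear_combination (1 - t) * h
    rw [this]
    exact neg_neg_of_pos (mul_pos ht0 hpa)
  · exact attackGain_neg_of_not_vulnerable hpa (hgen e) (inBox_deterrentEffort C0 Ce hpa ht0 ht1) he

theorem UdRho_deterrentEffort {C0 : ℝ} {Ce : E → ℝ} {pa pd t : ℝ} (hpa : 0 < pa)
    (hgen : ∀ e : E, pa ≠ Ce e - C0) (ht0 : 0 < t) (ht1 : t ≤ 1) {σa : Option E → ℝ}
    (ha : IsAtkMixed σa)
    (hbr : ∀ σa', IsAtkMixed σa' → UaRho C0 Ce pa (deterrentEffort C0 Ce pa t) σa'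
      ≤ UaRho C0 Ce pa (deterrentEffort C0 Ce pa t) σa) :
    UdRho C0 Ce pd (deterrentEffort C0 Ce pa t) σa = -C0
      - pd * ∑ e ∈ univ.filter (fun e => C0 < Ce e - pa), rhoHat C0 Ce pa e
      - t * (pd * ∑ e ∈ univ.filter (fun e => C0 < Ce e - pa), (1 - rhoHat C0 Ce pa e)) := by
  obtain ⟨u, -, -, hu0, -, -, hsupp⟩ := attacker_best_response ha hbr
  have hσ : ∀ e, σa (some e) = 0 := fun e => by
    have := attackGain_deterrentEffort_neg hpa hgen ht0 ht1 e
    exact (mul_eq_zero.1 (hsupp e)).resolve_right (by linarith)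
  rw [UdRho_eq C0 Ce pd _ ha, sub_sub, sub_right_inj, mul_sum, mul_sum, mul_sum,
    ← sum_add_distrib, sum_filter]
  refine sum_congr rfl fun e _ => ?_
  rw [hσ, deterrentEffort]
  split_ifs <;> ring

theorem spe_utilities {C0 : ℝ} {Ce : E → ℝ} {pa pd : ℝ} (hpa : 0 < pa) (hpd : 0 < pd)
    (hgen : ∀ e : E, pa ≠ Ce e - C0)
    (hsum : ∑ e ∈ Finset.univ.filter (fun e => C0 < Ce e - pa), pd / (Ce e - C0) < 1)
    {ρstar : E → ℝ} {σastar : (E → ℝ) → Option E → ℝ} (h : IsSPE C0 Ce pa pd ρstar σastar) :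
    UdRho C0 Ce pd ρstar (σastar ρstar)
      = -C0 - pd * ∑ e ∈ Finset.univ.filter (fun e => C0 < Ce e - pa),
          (Ce e - pa - C0) / (Ce e - C0) ∧
    UaRho C0 Ce pa ρstar (σastar ρstar) = C0 := by
  obtain ⟨hρ, hatk, hopt⟩ := h
  obtain ⟨ha, hbr⟩ := hatk ρstar hρ
  obtain ⟨u, hU, hu, hu0, hg, -, -⟩ := attacker_best_response ha hbr
  have hub := UdRho_le_of_best_response hpa hpd hρ ha hu hg
  have hlb : ∀ t, 0 < t → t ≤ 1 → -C0
      - pd * ∑ e ∈ univ.filter (fun e => C0 < Ce e - pa), (Ce e - pa - C0) / (Ce e - C0)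
      - t * (pd * ∑ e ∈ univ.filter (fun e => C0 < Ce e - pa), (1 - rhoHat C0 Ce pa e))
      ≤ UdRho C0 Ce pd ρstar (σastar ρstar) := fun t ht0 ht1 => by
    have hbox := inBox_deterrentEffort C0 Ce hpa ht0 ht1
    have := hopt _ hbox
    rwa [UdRho_deterrentEffort hpa hgen ht0 ht1 (hatk _ hbox).1 (hatk _ hbox).2] at this
  set L := -C0
    - pd * ∑ e ∈ univ.filter (fun e => C0 < Ce e - pa), (Ce e - pa - C0) / (Ce e - C0)
  set K := pd * ∑ e ∈ univ.filter (fun e => C0 < Ce e - pa), (1 - rhoHat C0 Ce pa e)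
  have hL : L ≤ UdRho C0 Ce pd ρstar (σastar ρstar) := by
    have hlim : Filter.Tendsto (fun t : ℝ => L - t * K) (nhdsWithin 0 (Set.Ioi 0)) (nhds L) := by
      have : Continuous fun t : ℝ => L - t * K := by fun_prop
      simpa using (this.tendsto 0).mono_left nhdsWithin_le_nhds
    refine le_of_tendsto hlim ?_
    filter_upwards [Ioc_mem_nhdsGT (zero_lt_one' ℝ)] with t ht
    exact hlb t ht.1 ht.2
  have hu_zero : u = 0 := by nlinarith
  subst hu_zero
  exact ⟨by linarith, by linarith⟩

/-- **Proposition 3, type I (Ĩ) regimes: equilibrium utilities.**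
Assume `V ≠ ∅`, `pa ≠ C_e − C0` for every `e`, and `∑_{e∈V} pd/(C_e−C0) < 1`. In every Nash
equilibrium of Γ the defender's utility is `−C0 − |V|·pd` and the attacker's utility is
`C0`; in every SPE of Γ̃ the defender's on-path utility is
`−C0 − pd·∑_{e∈V} (C_e−pa−C0)/(C_e−C0)` and the attacker's on-path utility is `C0`. -/
theorem equilibrium_utilities_typeI {E : Type*} [Fintype E] [DecidableEq E] [Nonempty E]
    (C0 : ℝ) (Ce : E → ℝ) (pa pd : ℝ) (hpa : 0 < pa) (hpd : 0 < pd)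
    (hV : ∃ e : E, C0 < Ce e - pa)
    (hgen : ∀ e : E, pa ≠ Ce e - C0)
    (hsum : ∑ e ∈ Finset.univ.filter (fun e => C0 < Ce e - pa), pd / (Ce e - C0) < 1) :
    (∀ (σd : Finset E → ℝ) (σa : Option E → ℝ), IsNE C0 Ce pa pd σd σa →
      Ud C0 Ce pd σd σa
        = -C0 - ((Finset.univ.filter (fun e => C0 < Ce e - pa)).card : ℝ) * pd ∧
      Ua C0 Ce pa σd σa = C0) ∧
    (∀ (ρstar : E → ℝ) (σastar : (E → ℝ) → Option E → ℝ),
      IsSPE C0 Ce pa pd ρstar σastar →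
      UdRho C0 Ce pd ρstar (σastar ρstar)
        = -C0 - pd * ∑ e ∈ Finset.univ.filter (fun e => C0 < Ce e - pa),
            (Ce e - pa - C0) / (Ce e - C0) ∧
      UaRho C0 Ce pa ρstar (σastar ρstar) = C0) := by
  exact ⟨fun _ _ h => nash_utilities hpa hpd hgen hsum h,
    fun _ _ h => spe_utilities hpa hpd hgen hsum h⟩

end SecGame
end
end

section
/- First-mover advantage for medium defense cost: assume pa ≠ C_e − C0 for every e ∈ E; suppose T ∈ {C_e : e ∈ E} satisfies T − C0 > pa, ∑_{e: C_e > T} pd/(C_e−C0) < 1, ∑_{e: C_e > T} pd/(C_e−C0) + ∑_{e: C_e = T} pd/(T−C0) > 1, and additionally −C0 − pd·∑_{e∈V}(C_e−pa−C0)/(C_e−C0) > −T − pd·∑_{e: C_e > T}(C_e−T)/(C_e−C0). Then every Nash equilibrium of Γ gives the defender utility −T − pd·∑_{e: C_e > T}(C_e−T)/(C_e−C0) and the attacker utility T − pa, while every SPE of Γ̃ gives the defender on-path utility −C0 − pd·∑_{e∈V}(C_e−pa−C0)/(C_e−C0) and the attacker on-path utility C0; consequently the defender's SPE utility strictly exceeds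 her NE utility and the attacker's SPE utility is strictly below his NE utility. -/
open Finset

noncomputable section

namespace SecGame

variable {E : Type*} [Fintype E] [DecidableEq E]

theorem sum_mul_sum_mem (σd : Finset E → ℝ) (a : E → ℝ) :
    ∑ sd : Finset E, σd sd * ∑ e : E, (if e ∈ sd then a e else 0) = ∑ e : E, effort σd e * a e := by
  simp only [effort, Finset.mul_sum, Finset.sum_mul]
  rw [Finset.sum_comm]
  refine Finset.sum_congr rfl fun e _ => ?_
  rw [Finset.sum_filter]
  refine Finset.sum_congr rfl fun sd _ => ?_
  split_ifs <;> simp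

theorem usageCost_some (C0 : ℝ) (Ce : E → ℝ) (sd : Finset E) (e : E) :
    usageCost C0 Ce sd (some e) = Ce e + if e ∈ sd then C0 - Ce e else 0 := by
  simp only [usageCost]
  split_ifs <;> ring

theorem sum_mul_usageCost (C0 : ℝ) (Ce : E → ℝ) (σa : Option E → ℝ) (sd : Finset E) :
    ∑ sa : Option E, σa sa * usageCost C0 Ce sd sa
      = C0 * σa none + ∑ e : E, Ce e * σa (some e)
        + ∑ e : E, if e ∈ sd then (C0 - Ce e) * σa (some e) else 0 := by
  rw [Fintype.sum_option, add_assoc, ← Finset.sum_add_distrib]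
  simp only [usageCost_some, mul_add, mul_ite, mul_zero]
  congr 1
  · simp only [usageCost]; ring
  · refine Finset.sum_congr rfl fun e _ => ?_
    split_ifs <;> ring

theorem card_eq_sum_mem (sd : Finset E) :
    (sd.card : ℝ) = ∑ e : E, if e ∈ sd then (1 : ℝ) else 0 := by
  simp

/-- The attacker's expected utility from attacking `e` under the security effort `ρ`. -/
def attackPayoff (C0 : ℝ) (Ce : E → ℝ) (pa : ℝ) (ρ : E → ℝ) (e : E) : ℝ :=
  Ce e - ρ e * (Ce e - C0) - pa

theorem UaRho_eq_sum (C0 : ℝ) (Ce : E → ℝ) (pa : ℝ) (ρ : E → ℝ) (σa : Option E → ℝ) :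
    UaRho C0 Ce pa ρ σa = σa none * C0 + ∑ e : E, σa (some e) * attackPayoff C0 Ce pa ρ e := by
  have h : ∑ e : E, σa (some e) * attackPayoff C0 Ce pa ρ e
      = ∑ e : E, (ρ e * (C0 - Ce e) * σa (some e) + Ce e * σa (some e))
        - pa * ∑ e : E, σa (some e) := by
    rw [Finset.mul_sum, ← Finset.sum_sub_distrib]
    exact Finset.sum_congr rfl fun e _ => by rw [attackPayoff]; ring
  rw [h, UaRho]
  ring

theorem UdRho_eq_UaRho (C0 : ℝ) (Ce : E → ℝ) (pa pd : ℝ) (ρ : E → ℝ) {σa : Option E → ℝ}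
    (ha : IsAtkMixed σa) :
    UdRho C0 Ce pd ρ σa = -UaRho C0 Ce pa ρ σa - pa * (1 - σa none) - pd * ∑ e : E, ρ e := by
  have h := ha.2
  rw [Fintype.sum_option] at h
  have split : ∑ e : E, (ρ e * ((C0 - Ce e) * σa (some e) + pd) + Ce e * σa (some e))
      = ∑ e : E, (ρ e * (C0 - Ce e) * σa (some e) + Ce e * σa (some e)) + pd * ∑ e : E, ρ e := by
    rw [Finset.mul_sum, ← Finset.sum_add_distrib]
    exact Finset.sum_congr rfl fun e _ => by ring
  rw [UdRho, UaRho, split]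
  linear_combination -pa * h

/-- Complementary slackness for an attacker best response. -/
theorem attacker_slackness {C0 : ℝ} {Ce : E → ℝ} {pa : ℝ} {ρ : E → ℝ} {σa : Option E → ℝ}
    (ha : IsAtkMixed σa)
    (hbr : ∀ σa', IsAtkMixed σa' → UaRho C0 Ce pa ρ σa' ≤ UaRho C0 Ce pa ρ σa) :
    C0 ≤ UaRho C0 Ce pa ρ σa ∧ (∀ e, attackPayoff C0 Ce pa ρ e ≤ UaRho C0 Ce pa ρ σa) ∧
    σa none * (UaRho C0 Ce pa ρ σa - C0) = 0 ∧
    ∀ e, σa (some e) * (UaRho C0 Ce pa ρ σa - attackPayoff C0 Ce pa ρ e) = 0 := by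
  have pure_mixed : ∀ a : Option E, IsAtkMixed (fun sa => if sa = a then (1 : ℝ) else 0) :=
    fun a => ⟨fun sa => by positivity, by simp⟩
  have h0 : C0 ≤ UaRho C0 Ce pa ρ σa := by
    simpa [UaRho_eq_sum C0 Ce pa ρ (fun sa => if sa = none then (1 : ℝ) else 0)]
      using hbr _ (pure_mixed none)
  have h1 : ∀ e, attackPayoff C0 Ce pa ρ e ≤ UaRho C0 Ce pa ρ σa := fun e => by
    simpa [UaRho_eq_sum C0 Ce pa ρ (fun sa => if sa = some e then (1 : ℝ) else 0)]
      using hbr _ (pure_mixed (some e))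
  refine ⟨h0, h1, ?_⟩
  have hsum := UaRho_eq_sum C0 Ce pa ρ σa
  set M := UaRho C0 Ce pa ρ σa
  have hone := ha.2
  rw [Fintype.sum_option] at hone
  have n0 : 0 ≤ σa none * (M - C0) := mul_nonneg (ha.1 _) (by linarith)
  have n1 : ∀ e ∈ Finset.univ, 0 ≤ σa (some e) * (M - attackPayoff C0 Ce pa ρ e) :=
    fun e _ => mul_nonneg (ha.1 _) (by linarith [h1 e])
  have total : σa none * (M - C0) + ∑ e : E, σa (some e) * (M - attackPayoff C0 Ce pa ρ e) = 0 := by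
    simp only [mul_sub, Finset.sum_sub_distrib, ← Finset.sum_mul]
    linear_combination M * hone + hsum
  have n2 := Finset.sum_nonneg n1
  refine ⟨by linarith, fun e => ?_⟩
  exact (Finset.sum_eq_zero_iff_of_nonneg n1).1 (by linarith) e (Finset.mem_univ e)

/-- Complementary slackness for a defender best response. -/
theorem defender_slackness {C0 : ℝ} {Ce : E → ℝ} {pd : ℝ} {σd : Finset E → ℝ}
    {σa : Option E → ℝ} (hd : IsDefMixed σd) (ha : IsAtkMixed σa)
    (hbr : ∀ σd', IsDefMixed σd' → Ud C0 Ce pd σd' σa ≤ Ud C0 Ce pd σd σa) (e : E) :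
    (pd < (Ce e - C0) * σa (some e) → effort σd e = 1) ∧
    ((Ce e - C0) * σa (some e) < pd → effort σd e = 0) := by
  set k : E → ℝ := fun e => (Ce e - C0) * σa (some e) - pd with hk
  set s : Finset E := Finset.univ.filter (fun e => 0 < k e) with hs
  have hpure : IsDefMixed (fun sd : Finset E => if sd = s then (1 : ℝ) else 0) :=
    ⟨fun sd => by positivity, by simp⟩
  have heff : ∀ e, effort (fun sd : Finset E => if sd = s then (1 : ℝ) else 0) e
      = if 0 < k e then 1 else 0 := by
    intro e
    simp [effort, Finset.sum_ite_eq', hs]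
  have hdev := hbr _ hpure
  rw [Ud_eq_UdRho C0 Ce pd hpure ha, Ud_eq_UdRho C0 Ce pd hd ha] at hdev
  have hform : ∀ ρ : E → ℝ, UdRho C0 Ce pd ρ σa
      = ∑ e : E, ρ e * k e - ∑ e : E, Ce e * σa (some e) - C0 * σa none := by
    intro ρ
    rw [UdRho, ← Finset.sum_sub_distrib, ← Finset.sum_neg_distrib]
    congr 1
    exact Finset.sum_congr rfl fun e _ => by rw [hk]; ring
  rw [hform, hform] at hdev
  simp only [heff] at hdev
  have hbox := hd.inBox_effort
  have hn : ∀ e ∈ Finset.univ, 0 ≤ ((if 0 < k e then 1 else 0) - effort σd e) * k e := by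
    intro e _
    obtain ⟨h0, h1⟩ := hbox e
    split_ifs with h
    · exact mul_nonneg (by linarith) h.le
    · exact mul_nonneg_of_nonpos_of_nonpos (by linarith) (not_lt.1 h)
  have hz : ∑ e : E, ((if 0 < k e then 1 else 0) - effort σd e) * k e = 0 := by
    refine le_antisymm ?_ (Finset.sum_nonneg hn)
    simp only [sub_mul, Finset.sum_sub_distrib]
    linarith
  have hze := (Finset.sum_eq_zero_iff_of_nonneg hn).1 hz e (Finset.mem_univ e)
  constructor
  · intro h
    have hke : 0 < k e := by simp only [hk]; linarith
    rw [if_pos hke] at hze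
    rcases mul_eq_zero.1 hze with h' | h' <;> linarith
  · intro h
    have hke : k e < 0 := by simp only [hk]; linarith
    rw [if_neg (not_lt.2 hke.le)] at hze
    rcases mul_eq_zero.1 hze with h' | h' <;> linarith

/-- Equilibrium utilities of the simultaneous game in the intermediate-cost regime. -/
theorem IsNE.utilities {C0 : ℝ} {Ce : E → ℝ} {pa pd : ℝ} (hpa : 0 < pa) (hpd : 0 < pd)
    {T : ℝ} (hvul : pa < T - C0)
    (hlt : ∑ e ∈ Finset.univ.filter (fun e => T < Ce e), pd / (Ce e - C0) < 1)
    (hgt : 1 < ∑ e ∈ Finset.univ.filter (fun e => T ≤ Ce e), pd / (Ce e - C0))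
    {σd : Finset E → ℝ} {σa : Option E → ℝ} (hne : IsNE C0 Ce pa pd σd σa) :
    Ud C0 Ce pd σd σa
      = -T - pd * ∑ e ∈ Finset.univ.filter (fun e => T < Ce e), (Ce e - T) / (Ce e - C0) ∧
    Ua C0 Ce pa σd σa = T - pa := by
  obtain ⟨hd, ha, hbd, hba⟩ := hne
  have hbox := hd.inBox_effort
  have hD := defender_slackness hd ha hbd
  simp only [Ua_eq_UaRho C0 Ce pa _ hd] at hba
  obtain ⟨-, hA1, hA2, hA3⟩ := attacker_slackness ha hba
  rw [Ud_eq_UdRho C0 Ce pd hd ha, Ua_eq_UaRho C0 Ce pa _ hd,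
    UdRho_eq_UaRho C0 Ce pa pd (effort σd) ha]
  set M := UaRho C0 Ce pa (effort σd) σa
  set ρ := effort σd
  simp only [attackPayoff] at hA1 hA3
  have hone := ha.2
  rw [Fintype.sum_option] at hone
  have hM1 : T - pa ≤ M := by
    by_contra! hM
    have hle : ∑ e ∈ Finset.univ.filter (fun e => T ≤ Ce e), pd / (Ce e - C0)
        ≤ ∑ e : E, σa (some e) := by
      refine (Finset.sum_le_sum fun e he => ?_).trans
        (Finset.sum_le_sum_of_subset_of_nonneg (Finset.filter_subset _ _) fun e _ _ => ha.1 _)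
      have hCe : T ≤ Ce e := (Finset.mem_filter.1 he).2
      rw [div_le_iff₀ (by linarith)]
      by_contra! hcon
      have h0 := (hD e).2 (by linarith)
      have := hA1 e
      rw [h0] at this
      linarith
    linarith [ha.1 none]
  have hnone : σa none = 0 := (mul_eq_zero.1 hA2).resolve_right (by linarith)
  have hM2 : M ≤ T - pa := by
    by_contra! hM
    have hle : ∑ e : E, σa (some e)
        ≤ ∑ e ∈ Finset.univ.filter (fun e => T < Ce e), pd / (Ce e - C0) := by
      rw [Finset.sum_filter]
      refine Finset.sum_le_sum fun e _ => ?_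
      obtain ⟨h0, h1⟩ := hbox e
      split_ifs with hCe
      · rw [le_div_iff₀ (by linarith)]
        by_contra! hcon
        have hρ := (hD e).1 (by linarith)
        rcases mul_eq_zero.1 (hA3 e) with h | h
        · rw [h] at hcon; linarith
        · rw [hρ] at h; linarith
      · refine ((mul_eq_zero.1 (hA3 e)).resolve_right ?_).le
        have : Ce e - ρ e * (Ce e - C0) ≤ T := by
          nlinarith [mul_nonneg (sub_nonneg.2 h1) (sub_nonneg.2 (not_lt.1 hCe)),
            mul_nonneg h0 (show 0 ≤ T - C0 by linarith)]
        linarith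
    linarith
  have hM : M = T - pa := le_antisymm hM2 hM1
  have hρ : ∀ e, ρ e = if T < Ce e then (Ce e - T) / (Ce e - C0) else 0 := by
    intro e
    obtain ⟨h0, h1⟩ := hbox e
    have hAe := hA1 e
    split_ifs with hCe
    · rw [eq_div_iff (by linarith)]
      have hpos : ρ e ≠ 0 := by
        intro h
        rw [h] at hAe
        linarith
      have hσ : σa (some e) ≠ 0 := by
        intro h
        exact hpos ((hD e).2 (by rw [h]; linarith))
      linarith [(mul_eq_zero.1 (hA3 e)).resolve_left hσ]
    · have hCe' := not_lt.1 hCe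
      rcases mul_eq_zero.1 (hA3 e) with h | h
      · exact (hD e).2 (by rw [h]; linarith)
      · have h3 : (1 - ρ e) * (T - Ce e) + ρ e * (T - C0) = 0 := by linarith
        have h4 := mul_nonneg (sub_nonneg.2 h1) (sub_nonneg.2 hCe')
        have h5 := mul_nonneg h0 (show 0 ≤ T - C0 by linarith)
        have h6 : ρ e * (T - C0) = 0 := by linarith
        exact (mul_eq_zero.1 h6).resolve_right (by linarith)
  refine ⟨?_, hM⟩
  rw [hnone, hM, Finset.sum_filter, Finset.sum_congr rfl fun e _ => hρ e]
  ring

/-- If the attacker profits from attacking, the defender gets at most her utility in the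
simultaneous game. -/
theorem UdRho_le_of_attack {C0 : ℝ} {Ce : E → ℝ} {pa pd : ℝ} (hpd : 0 < pd)
    {T : ℝ} (hT : C0 < T)
    (hlt : ∑ e ∈ Finset.univ.filter (fun e => T < Ce e), pd / (Ce e - C0) < 1)
    (hgt : 1 < ∑ e ∈ Finset.univ.filter (fun e => T ≤ Ce e), pd / (Ce e - C0))
    {ρ : E → ℝ} (hρ : InBox ρ) {σa : Option E → ℝ} (ha : IsAtkMixed σa)
    (hbr : ∀ σa', IsAtkMixed σa' → UaRho C0 Ce pa ρ σa' ≤ UaRho C0 Ce pa ρ σa)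
    (hM : C0 < UaRho C0 Ce pa ρ σa) :
    UdRho C0 Ce pd ρ σa
      ≤ -T - pd * ∑ e ∈ Finset.univ.filter (fun e => T < Ce e), (Ce e - T) / (Ce e - C0) := by
  obtain ⟨-, hA1, hA2, -⟩ := attacker_slackness ha hbr
  rw [UdRho_eq_UaRho C0 Ce pa pd ρ ha]
  have hnone : σa none = 0 := (mul_eq_zero.1 hA2).resolve_right (by linarith)
  rw [hnone]
  obtain ⟨t, ht⟩ : ∃ t, t = UaRho C0 Ce pa ρ σa + pa := ⟨_, rfl⟩
  have hlb : ∀ e, T ≤ Ce e →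
      pd * ((Ce e - T) / (Ce e - C0)) + (T - t) * (pd / (Ce e - C0)) ≤ pd * ρ e := by
    intro e hCe
    have hpos : 0 < Ce e - C0 := by linarith
    have h := hA1 e
    rw [attackPayoff] at h
    have : pd * ((Ce e - T) / (Ce e - C0)) + (T - t) * (pd / (Ce e - C0))
        = pd * ((Ce e - t) / (Ce e - C0)) := by ring
    rw [this]
    refine mul_le_mul_of_nonneg_left ?_ hpd.le
    rw [div_le_iff₀ hpos]
    linarith
  have hbound : ∀ s : Finset E, (∀ e ∈ s, T ≤ Ce e) →
      pd * ∑ e ∈ s, (Ce e - T) / (Ce e - C0) + (T - t) * ∑ e ∈ s, pd / (Ce e - C0)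
        ≤ pd * ∑ e : E, ρ e := by
    intro s hs
    rw [Finset.mul_sum, Finset.mul_sum, ← Finset.sum_add_distrib]
    refine (Finset.sum_le_sum fun e he => hlb e (hs e he)).trans ?_
    rw [← Finset.mul_sum]
    exact mul_le_mul_of_nonneg_left (Finset.sum_le_sum_of_subset_of_nonneg
      (Finset.subset_univ s) fun e _ _ => (hρ e).1) hpd.le
  rcases le_total T t with h | h
  · have := hbound (Finset.univ.filter (fun e => T < Ce e))
      fun e he => (Finset.mem_filter.1 he).2.le
    nlinarith [mul_nonneg (sub_nonneg.2 h) (sub_nonneg.2 hlt.le)]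
  · have := hbound (Finset.univ.filter (fun e => T ≤ Ce e)) fun e he => (Finset.mem_filter.1 he).2
    have heq : ∑ e ∈ Finset.univ.filter (fun e => T ≤ Ce e), (Ce e - T) / (Ce e - C0)
        = ∑ e ∈ Finset.univ.filter (fun e => T < Ce e), (Ce e - T) / (Ce e - C0) := by
      rw [Finset.sum_filter, Finset.sum_filter]
      refine Finset.sum_congr rfl fun e _ => ?_
      rcases lt_trichotomy T (Ce e) with h | h | h
      · simp [h, h.le]
      · simp [h]
      · simp [h.not_ge, h.not_gt]
    rw [heq] at this
    nlinarith [mul_nonneg (sub_nonneg.2 h) (sub_nonneg.2 hgt.le)]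

/-- If the attacker is deterred, the defender pays at least for the threshold efforts. -/
theorem UdRho_le_of_deterred {C0 : ℝ} {Ce : E → ℝ} {pa pd : ℝ} (hpa : 0 < pa) (hpd : 0 < pd)
    {ρ : E → ℝ} (hρ : InBox ρ) {σa : Option E → ℝ} (ha : IsAtkMixed σa)
    (hbr : ∀ σa', IsAtkMixed σa' → UaRho C0 Ce pa ρ σa' ≤ UaRho C0 Ce pa ρ σa)
    (hM : UaRho C0 Ce pa ρ σa = C0) :
    UdRho C0 Ce pd ρ σa
      ≤ -C0 - pd * ∑ e ∈ Finset.univ.filter (fun e => C0 < Ce e - pa),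
          (Ce e - pa - C0) / (Ce e - C0) := by
  obtain ⟨-, hA1, -, -⟩ := attacker_slackness ha hbr
  rw [UdRho_eq_UaRho C0 Ce pa pd ρ ha]
  rw [hM] at hA1 ⊢
  have hone := ha.2
  rw [Fintype.sum_option] at hone
  have hs : 0 ≤ ∑ e : E, σa (some e) := Finset.sum_nonneg fun e _ => ha.1 _
  have hle : ∑ e ∈ Finset.univ.filter (fun e => C0 < Ce e - pa), (Ce e - pa - C0) / (Ce e - C0)
      ≤ ∑ e : E, ρ e := by
    refine (Finset.sum_le_sum fun e he => ?_).trans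
      (Finset.sum_le_sum_of_subset_of_nonneg (Finset.filter_subset _ _) fun e _ _ => (hρ e).1)
    have hCe : C0 < Ce e - pa := (Finset.mem_filter.1 he).2
    have h := hA1 e
    rw [attackPayoff] at h
    rw [div_le_iff₀ (by linarith)]
    linarith
  have h1 := mul_le_mul_of_nonneg_left hle hpd.le
  have h2 : 0 ≤ pa * (1 - σa none) := mul_nonneg hpa.le (by linarith)
  linarith

/-- By exceeding the threshold efforts slightly, the first mover secures nearly the
full-deterrence utility. -/
theorem IsSPE.deterrence_le_UdRho {C0 : ℝ} {Ce : E → ℝ} {pa pd : ℝ} (hpa : 0 < pa)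
    (hgen : ∀ e : E, pa ≠ Ce e - C0)
    {ρstar : E → ℝ} {σastar : (E → ℝ) → Option E → ℝ} (hspe : IsSPE C0 Ce pa pd ρstar σastar) :
    -C0 - pd * ∑ e ∈ Finset.univ.filter (fun e => C0 < Ce e - pa), (Ce e - pa - C0) / (Ce e - C0)
      ≤ UdRho C0 Ce pd ρstar (σastar ρstar) := by
  obtain ⟨-, hbr, hopt⟩ := hspe
  set S := ∑ e ∈ Finset.univ.filter (fun e => C0 < Ce e - pa), (Ce e - pa - C0) / (Ce e - C0)
    with hS
  set R := ∑ e ∈ Finset.univ.filter (fun e => C0 < Ce e - pa), pa / (Ce e - C0) with hR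
  have key : ∀ ε : ℝ, 0 < ε → ε ≤ 1 →
      -C0 - pd * (S + ε * R) ≤ UdRho C0 Ce pd ρstar (σastar ρstar) := by
    intro ε hε hε1
    obtain ⟨ρ, hρ⟩ : ∃ ρ : E → ℝ, ∀ e, ρ e = if C0 < Ce e - pa then
        (Ce e - pa - C0) / (Ce e - C0) + ε * (pa / (Ce e - C0)) else 0 := ⟨_, fun _ => rfl⟩
    have hbox : InBox ρ := by
      intro e
      rw [hρ]
      split_ifs with h
      · have hpos : 0 < Ce e - C0 := by linarith
        have h1 : (Ce e - pa - C0) / (Ce e - C0) + ε * (pa / (Ce e - C0))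
            = (Ce e - pa - C0 + ε * pa) / (Ce e - C0) := by ring
        rw [h1]
        refine ⟨div_nonneg (by nlinarith) hpos.le, ?_⟩
        rw [div_le_one hpos]
        nlinarith
      · simp
    obtain ⟨ha, hb⟩ := hbr ρ hbox
    obtain ⟨hC, -, hA2, hA3⟩ := attacker_slackness ha hb
    have hu : ∀ e, attackPayoff C0 Ce pa ρ e < C0 := by
      intro e
      rw [attackPayoff, hρ]
      split_ifs with h
      · have hpos : 0 < Ce e - C0 := by linarith
        have h1 : ((Ce e - pa - C0) / (Ce e - C0) + ε * (pa / (Ce e - C0))) * (Ce e - C0)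
            = Ce e - pa - C0 + ε * pa := by
          field_simp
        rw [h1]
        nlinarith [mul_pos hε hpa]
      · rcases lt_or_eq_of_le (not_lt.1 h) with h | h
        · linarith
        · exact absurd (by linarith) (hgen e)
    have hz : ∀ e, σastar ρ (some e) = 0 := fun e =>
      (mul_eq_zero.1 (hA3 e)).resolve_right (by linarith [hu e])
    have hnone : σastar ρ none = 1 := by
      have h := ha.2
      rw [Fintype.sum_option] at h
      simpa [hz] using h
    have hval : UdRho C0 Ce pd ρ (σastar ρ) = -C0 - pd * (S + ε * R) := by
      rw [UdRho_eq_UaRho C0 Ce pa pd ρ ha, UaRho_eq_sum]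
      have hsum : ∑ e : E, ρ e = S + ε * R := by
        rw [hS, hR, Finset.mul_sum, ← Finset.sum_add_distrib, Finset.sum_filter]
        exact Finset.sum_congr rfl fun e _ => hρ e
      rw [hsum]
      simp [hz, hnone]
    rw [← hval]
    exact hopt ρ hbox
  have hlim : Filter.Tendsto (fun ε : ℝ => -C0 - pd * (S + ε * R)) (nhdsWithin 0 (Set.Ioi 0))
      (nhds (-C0 - pd * (S + 0 * R))) :=
    (Continuous.tendsto (by fun_prop) 0).mono_left nhdsWithin_le_nhds
  rw [zero_mul, add_zero] at hlim
  refine le_of_tendsto hlim ?_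
  filter_upwards [Ioc_mem_nhdsGT (zero_lt_one' ℝ)] with ε hε
  exact key ε hε.1 hε.2

/-- **First-mover advantage for relatively medium defense cost (set M).**
Assume `pa ≠ C_e − C0` for every `e`, the type II regime conditions for some
`T ∈ {C_e}`, and additionally that the full-deterrence utility exceeds the type II
utility: `−C0 − pd·∑_{e∈V} ρ̂_e > −T − pd·∑_{C_e>T}(C_e−T)/(C_e−C0)`.
Then every NE of Γ gives the defender `−T − pd·∑_{C_e>T}(C_e−T)/(C_e−C0)` and the
attacker `T − pa`, while every SPE of Γ̃ gives the defender on-path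
`−C0 − pd·∑_{e∈V}(C_e−pa−C0)/(C_e−C0)` and the attacker on-path `C0`; consequently the
defender's SPE utility strictly exceeds her NE utility and the attacker's SPE utility is
strictly below his NE utility. -/
theorem first_mover_advantage_medium_cost {E : Type*} [Fintype E] [DecidableEq E] [Nonempty E]
    (C0 : ℝ) (Ce : E → ℝ) (pa pd : ℝ) (hpa : 0 < pa) (hpd : 0 < pd)
    (hgen : ∀ e : E, pa ≠ Ce e - C0)
    (T : ℝ) (hT : ∃ e : E, Ce e = T)
    (hvul : pa < T - C0)
    (hlt : ∑ e ∈ Finset.univ.filter (fun e => T < Ce e), pd / (Ce e - C0) < 1)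
    (hgt : 1 < (∑ e ∈ Finset.univ.filter (fun e => T < Ce e), pd / (Ce e - C0))
      + ∑ e ∈ Finset.univ.filter (fun e => Ce e = T), pd / (T - C0))
    (hmed : -C0 - pd * ∑ e ∈ Finset.univ.filter (fun e => C0 < Ce e - pa),
        (Ce e - pa - C0) / (Ce e - C0)
      > -T - pd * ∑ e ∈ Finset.univ.filter (fun e => T < Ce e), (Ce e - T) / (Ce e - C0)) :
    ∀ (σd : Finset E → ℝ) (σa : Option E → ℝ), IsNE C0 Ce pa pd σd σa →
      ∀ (ρstar : E → ℝ) (σastar : (E → ℝ) → Option E → ℝ),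
        IsSPE C0 Ce pa pd ρstar σastar →
          Ud C0 Ce pd σd σa
            = -T - pd * ∑ e ∈ Finset.univ.filter (fun e => T < Ce e),
                (Ce e - T) / (Ce e - C0) ∧
          Ua C0 Ce pa σd σa = T - pa ∧
          UdRho C0 Ce pd ρstar (σastar ρstar)
            = -C0 - pd * ∑ e ∈ Finset.univ.filter (fun e => C0 < Ce e - pa),
                (Ce e - pa - C0) / (Ce e - C0) ∧
          UaRho C0 Ce pa ρstar (σastar ρstar) = C0 ∧
          UdRho C0 Ce pd ρstar (σastar ρstar) > Ud C0 Ce pd σd σa ∧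
          UaRho C0 Ce pa ρstar (σastar ρstar) < Ua C0 Ce pa σd σa := by
  intro σd σa hne ρstar σastar hspe
  have hgt' : 1 < ∑ e ∈ Finset.univ.filter (fun e => T ≤ Ce e), pd / (Ce e - C0) := by
    refine hgt.trans_eq ?_
    simp only [Finset.sum_filter]
    rw [← Finset.sum_add_distrib]
    refine Finset.sum_congr rfl fun e _ => ?_
    rcases lt_trichotomy T (Ce e) with h | h | h
    · simp [h, h.le, h.ne']
    · simp [h]
    · simp [h.not_ge, h.not_gt, h.ne]
  obtain ⟨hUd, hUa⟩ := hne.utilities hpa hpd hvul hlt hgt'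
  have hlow := hspe.deterrence_le_UdRho hpa hgen
  obtain ⟨ha, hbr⟩ := hspe.2.1 ρstar hspe.1
  have hC := (attacker_slackness ha hbr).1
  have hM : UaRho C0 Ce pa ρstar (σastar ρstar) = C0 := by
    refine le_antisymm (not_lt.1 fun h => ?_) hC
    have := UdRho_le_of_attack hpd (by linarith) hlt hgt' hspe.1 ha hbr h
    linarith
  have hup := UdRho_le_of_deterred hpa hpd hspe.1 ha hbr hM
  have hval := le_antisymm hup hlow
  refine ⟨hUd, hUa, hval, hM, ?_, ?_⟩
  · rw [hval, hUd]; exact hmed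
  · rw [hM, hUa]; linarith

end SecGame
end
end
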